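/- arXiv:2511.02444 — 2 statements merged into one kernel-verified Lean document; each statement's English description precedes it below -/
import Mathlib

section
/- Let κ, δ, b, c be real numbers with κδ > 0, c ≥ 0 and b > c. Let x : ℝ → ℝ be a measurable function, let t₁ < t₂ be real numbers, suppose |x(t)| ≤ c for all t ∈ [t₁, t₂], and suppose the firing condition ∫_{t₁}^{t₂} (x(t) + b) dt = κδ holds. Then the firing-time difference T = t₂ − t₁ satisfies κδ/(b + c) ≤ T ≤ κδ/(b − c). -/
open MeasureTheory intervalIntegral

/-- IF-TEM firing-time difference bounds: if the biased signal integrates to the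
threshold `κ * δ` over `[t₁, t₂]` and `|x t| ≤ c < b` on that interval, then
`κδ/(b+c) ≤ t₂ - t₁ ≤ κδ/(b-c)`. -/
theorem iftem_firing_time_bounds
    (κ δ b c : ℝ) (hκδ : 0 < κ * δ) (hc : 0 ≤ c) (hbc : c < b)
    (x : ℝ → ℝ) (hx : Measurable x)
    (t₁ t₂ : ℝ) (ht : t₁ < t₂)
    (hbound : ∀ t ∈ Set.Icc t₁ t₂, |x t| ≤ c)
    (hfire : ∫ t in t₁..t₂, (x t + b) = κ * δ) :
    κ * δ / (b + c) ≤ t₂ - t₁ ∧ t₂ - t₁ ≤ κ * δ / (b - c) := by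
  have hint : IntervalIntegrable (fun t => x t + b) volume t₁ t₂ := by
    refine (intervalIntegrable_const (c := c + |b|)).mono_fun'
      (hx.add_const b).aestronglyMeasurable ?_
    rw [Set.uIoc_of_le ht.le]
    filter_upwards [ae_restrict_mem measurableSet_Ioc] with t htm
    exact (abs_add_le (x t) b).trans
      (by linarith [hbound t (Set.Ioc_subset_Icc_self htm)])
  have hlower : (t₂ - t₁) * (b - c) ≤ κ * δ := by
    have h := integral_mono_on ht.le
      (intervalIntegrable_const (c := b - c)) hint
      (fun t htm => by linarith [(abs_le.mp (hbound t htm)).1])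
    rwa [hfire, intervalIntegral.integral_const, smul_eq_mul] at h
  have hupper : κ * δ ≤ (t₂ - t₁) * (b + c) := by
    have h := integral_mono_on ht.le hint
      (intervalIntegrable_const (c := b + c))
      (fun t htm => by linarith [(abs_le.mp (hbound t htm)).2])
    rwa [hfire, intervalIntegral.integral_const, smul_eq_mul] at h
  exact ⟨(div_le_iff₀ (by linarith)).mpr hupper, (le_div_iff₀ (by linarith)).mpr hlower⟩
end

section
/- Let κ, δ, β > 0 and c̄ ≥ 0. Let c be a real random variable with c ∈ [0, c̄] almost surely, and define the random variable T = κδ/(2c + β). Then Var(T) ≥ ((2κδ)²/(2c̄ + β)⁴) · Var(c). -/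
open MeasureTheory ProbabilityTheory

/-- If the squared distance of `Y` to its mean dominates `k` times the squared distance of `X` to
some constant, then `k * Var[X] ≤ Var[Y]`. -/
lemma mul_variance_le_variance_of_ae_le {Ω : Type*} [MeasurableSpace Ω] {μ : Measure Ω}
    [IsProbabilityMeasure μ] {X Y : Ω → ℝ} (hX : AEStronglyMeasurable X μ) (hY : MemLp Y 2 μ)
    {k : ℝ} (hk : 0 ≤ k) (a : ℝ)
    (h : ∀ᵐ ω ∂μ, k * (X ω - a) ^ 2 ≤ (Y ω - ∫ x, Y x ∂μ) ^ 2) :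
    k * variance X μ ≤ variance Y μ := by
  have hvar : variance X μ ≤ ∫ ω, (X ω - a) ^ 2 ∂μ := by
    rw [← variance_sub_const hX a]
    exact variance_le_expectation_sq (hX.sub aestronglyMeasurable_const)
  calc k * variance X μ ≤ k * ∫ ω, (X ω - a) ^ 2 ∂μ := mul_le_mul_of_nonneg_left hvar hk
    _ = ∫ ω, k * (X ω - a) ^ 2 ∂μ := (integral_const_mul _ _).symm
    _ ≤ ∫ ω, (Y ω - ∫ x, Y x ∂μ) ^ 2 ∂μ :=
      integral_mono_of_nonneg (ae_of_all _ fun ω => by positivity)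
        (hY.sub (memLp_const _)).integrable_sq h
    _ = variance Y μ := (variance_eq_integral hY.aestronglyMeasurable.aemeasurable).symm

/-- The reciprocal contracts `(0, M]` by at most the factor `M⁻²`. -/
lemma mul_sq_sub_le_sq_div_sub_div {K M x y : ℝ} (hx : 0 < x) (hxM : x ≤ M) (hy : 0 < y)
    (hyM : y ≤ M) : K ^ 2 / M ^ 4 * (x - y) ^ 2 ≤ (K / x - K / y) ^ 2 := by
  have hxy : (K / x - K / y) ^ 2 = K ^ 2 * (x - y) ^ 2 / (x * y) ^ 2 := by
    field_simp
    ring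
  have hM : (x * y) ^ 2 ≤ M ^ 4 := by
    calc (x * y) ^ 2 ≤ (M * M) ^ 2 := by gcongr; exact hx.le.trans hxM
      _ = M ^ 4 := by ring
  rw [hxy, div_mul_eq_mul_div]
  gcongr

/-- Variance relation between AIF-TEM firing-time differences and local
amplitudes: for an amplitude `c ∈ [0, c̄]` a.s. and `T = κδ/(2c + β)`,
`Var(T) ≥ ((2κδ)²/(2c̄ + β)⁴) Var(c)`. -/
theorem aiftem_variance_relation
    {Ω : Type*} [MeasureSpace Ω] [IsProbabilityMeasure (ℙ : Measure Ω)]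
    (κ δ β cbar : ℝ) (hκ : 0 < κ) (hδ : 0 < δ) (hβ : 0 < β) (hcbar : 0 ≤ cbar)
    (c : Ω → ℝ) (hc : Measurable c)
    (hbound : ∀ᵐ ω ∂ℙ, c ω ∈ Set.Icc 0 cbar) :
    ((2 * (κ * δ)) ^ 2 / (2 * cbar + β) ^ 4) * variance c ℙ ≤
      variance (fun ω => κ * δ / (2 * c ω + β)) ℙ := by
  have hK : 0 < κ * δ := mul_pos hκ hδ
  generalize κ * δ = K at hK ⊢
  have hM : 0 < 2 * cbar + β := by positivity
  have hTbound : ∀ᵐ ω ∂ℙ, K / (2 * c ω + β) ∈ Set.Icc (K / (2 * cbar + β)) (K / β) := by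
    filter_upwards [hbound] with ω ⟨h0, h1⟩
    constructor <;> gcongr
    linarith
  have hT : MemLp (fun ω => K / (2 * c ω + β)) 2 ℙ :=
    memLp_of_bounded hTbound (by fun_prop : Measurable _).aestronglyMeasurable 2
  have hint := hT.integrable one_le_two
  set m := ∫ ω, K / (2 * c ω + β) with hm
  have hm_lower : K / (2 * cbar + β) ≤ m := by
    simpa using integral_mono_ae (integrable_const _) hint (hTbound.mono fun _ h => h.1)
  have hm_pos : 0 < m := (div_pos hK hM).trans_le hm_lower
  have hy_le : K / m ≤ 2 * cbar + β := (div_le_comm₀ hM hm_pos).1 hm_lower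
  refine mul_variance_le_variance_of_ae_le hc.aestronglyMeasurable hT (by positivity)
    ((K / m - β) / 2) ?_
  filter_upwards [hbound] with ω ⟨h0, h1⟩
  have h := mul_sq_sub_le_sq_div_sub_div (K := K) (M := 2 * cbar + β) (x := 2 * c ω + β)
    (y := K / m) (by positivity) (by linarith) (div_pos hK hm_pos) hy_le
  rw [div_div_cancel₀ hK.ne'] at h
  calc _ = K ^ 2 / (2 * cbar + β) ^ 4 * (2 * c ω + β - K / m) ^ 2 := by ring
    _ ≤ _ := h
end
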